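/- Let K be a field, κ an infinite cardinal, R = R(κ,K), and let λ be an infinite cardinal with λ ≤ κ⁺. Let M_λ be the R-submodule of K^κ consisting of all f : κ → K whose support has cardinality < λ. Then M_λ is λ-injective: for every ideal I of R that can be generated by fewer than λ elements and every R-linear map φ : I → M_λ, there exists an R-linear map ψ : R → M_λ with ψ restricted to I equal to φ. -/

import Mathlib

/-- The `K`-subalgebra `R(κ,K)` of `K^κ` consisting of all eventually constant functions:
all `f : ι → K` such that for some `c ∈ K`, `f a = c` for all but finitely many `a`. -/
def Rconst (K ι : Type*) [Field K] : Subalgebra K (ι → K) where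
  carrier := {f | ∃ c : K, {a | f a ≠ c}.Finite}
  mul_mem' := by
    rintro f g ⟨c, hc⟩ ⟨d, hd⟩
    refine ⟨c * d, (hc.union hd).subset fun a ha => ?_⟩
    by_contra h
    simp only [Set.mem_union, Set.mem_setOf_eq, not_or, not_not] at h
    exact ha (show (f * g) a = _ by rw [Pi.mul_apply, h.1, h.2])
  add_mem' := by
    rintro f g ⟨c, hc⟩ ⟨d, hd⟩
    refine ⟨c + d, (hc.union hd).subset fun a ha => ?_⟩
    by_contra h
    simp only [Set.mem_union, Set.mem_setOf_eq, not_or, not_not] at h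
    exact ha (show (f + g) a = _ by rw [Pi.add_apply, h.1, h.2])
  algebraMap_mem' := fun c => ⟨c, by simp [Set.finite_empty]⟩

set_option synthInstance.maxHeartbeats 1000000 in
set_option maxHeartbeats 2000000 in
/-- The `R(κ,K)`-submodule `M_λ` of `K^κ` consisting of all functions whose support has
cardinality `< λ`. -/
def Mlam (K ι : Type u) [Field K] (lam : Cardinal.{u}) (hlam : Cardinal.aleph0 ≤ lam) :
    Submodule (Rconst K ι) (ι → K) where
  carrier := {f | Cardinal.mk {a | f a ≠ 0} < lam}
  add_mem' := by
    intro f g hf hg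
    refine lt_of_le_of_lt ?_ (Cardinal.add_lt_of_lt hlam hf hg)
    refine le_trans (Cardinal.mk_le_mk_of_subset fun a ha => ?_) (Cardinal.mk_union_le _ _)
    by_contra h
    simp only [Set.mem_union, Set.mem_setOf_eq, not_or, not_not] at h
    exact ha (show (f + g) a = 0 by rw [Pi.add_apply, h.1, h.2, add_zero])
  zero_mem' := by
    have he : {a : ι | (0 : ι → K) a ≠ 0} = ∅ := by simp
    show Cardinal.mk {a : ι | (0 : ι → K) a ≠ 0} < lam
    rw [he]
    simpa using lt_of_lt_of_le Cardinal.aleph0_pos hlam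
  smul_mem' := by
    intro c f hf
    refine lt_of_le_of_lt (Cardinal.mk_le_mk_of_subset fun a ha => ?_) hf
    by_contra h
    simp only [Set.mem_setOf_eq, not_not] at h
    exact ha (show (c • f) a = 0 by
      show (c : ι → K) a * f a = 0
      rw [h, mul_zero])

open Classical in
/-- The indicator function of a single point is eventually constant. -/
noncomputable def Rconst.single (K : Type*) {ι : Type*} [Field K] (a : ι) : Rconst K ι :=
  ⟨Pi.single a 1, 0, (Set.finite_singleton a).subset fun b hb => by
    by_contra h
    exact hb (Pi.single_eq_of_ne h 1)⟩

theorem Rconst.single_apply_self {K ι : Type*} [Field K] (a : ι) :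
    (Rconst.single K a : ι → K) a = 1 := by
  classical
  simp [Rconst.single]

theorem Rconst.single_mul {K ι : Type*} [Field K] (a : ι) (f : Rconst K ι) :
    Rconst.single K a * f = algebraMap K (Rconst K ι) ((f : ι → K) a) * Rconst.single K a := by
  classical
  apply Subtype.ext
  funext b
  change (Rconst.single K a : ι → K) b * (f : ι → K) b
    = (f : ι → K) a * (Rconst.single K a : ι → K) b
  by_cases h : b = a
  · subst h
    exact mul_comm _ _
  · have : (Rconst.single K a : ι → K) b = 0 := Pi.single_eq_of_ne h 1
    rw [this, zero_mul, mul_zero]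

theorem Rconst.single_mem_of_apply_ne_zero {K ι : Type*} [Field K] {I : Ideal (Rconst K ι)}
    {f : Rconst K ι} (hf : f ∈ I) {a : ι} (ha : (f : ι → K) a ≠ 0) : Rconst.single K a ∈ I := by
  have h : algebraMap K (Rconst K ι) ((f : ι → K) a)⁻¹ * (Rconst.single K a * f) ∈ I :=
    I.mul_mem_left _ (I.mul_mem_left _ hf)
  rwa [Rconst.single_mul, ← mul_assoc, ← map_mul, inv_mul_cancel₀ ha, map_one, one_mul] at h

/-- An eventually constant function has finite or cofinite support. -/
theorem Rconst.finite_support_or_finite_zeros {K ι : Type*} [Field K] (f : Rconst K ι) :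
    {a | (f : ι → K) a ≠ 0}.Finite ∨ {a | (f : ι → K) a = 0}.Finite := by
  obtain ⟨c, hc⟩ := f.2
  by_cases h : c = 0
  · subst h
    exact Or.inl hc
  · exact Or.inr (hc.subset fun a (ha : (f : ι → K) a = 0) (e : (f : ι → K) a = c) =>
      h (e.symm.trans ha))

/-- If all elements of a set vanish at a point, so do all elements of the ideal it spans. -/
theorem Rconst.apply_eq_zero_of_mem_span {K ι : Type*} [Field K] {S : Set (Rconst K ι)} {a : ι}
    (hS : ∀ s ∈ S, (s : ι → K) a = 0) {f : Rconst K ι} (hf : f ∈ Ideal.span S) :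
    (f : ι → K) a = 0 := by
  have h : Ideal.span S ≤ RingHom.ker ((Pi.evalRingHom (fun _ : ι => K) a).comp
      (Rconst K ι).val.toRingHom) :=
    Ideal.span_le.2 fun s hs => hS s hs
  exact h hf

theorem Cardinal.mk_biUnion_lt_of_finite {α ι : Type u} {lam : Cardinal.{u}}
    (hlam : Cardinal.aleph0 ≤ lam) {S : Set α} (hS : Cardinal.mk S < lam) {A : α → Set ι}
    (hA : ∀ s ∈ S, (A s).Finite) : Cardinal.mk (⋃ s ∈ S, A s : Set ι) < lam := by
  by_cases hfin : S.Finite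
  · exact lt_of_lt_of_le (Cardinal.lt_aleph0_iff_set_finite.2 (hfin.biUnion hA)) hlam
  · have hinf : Cardinal.aleph0 ≤ Cardinal.mk S := by
      rw [← not_lt, Cardinal.lt_aleph0_iff_set_finite]
      exact hfin
    refine lt_of_le_of_lt (Cardinal.mk_biUnion_le _ _) (lt_of_le_of_lt ?_ hS)
    refine (mul_le_mul_right (ciSup_le' fun s => ?_) _).trans
      (Cardinal.mul_aleph0_eq hinf).le
    exact (Cardinal.lt_aleph0_iff_set_finite.2 (hA s s.2)).le

section

variable {K ι : Type u} [Field K] {lam : Cardinal.{u}} {hlam : Cardinal.aleph0 ≤ lam}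
  {I : Ideal (Rconst K ι)} (φ : I →ₗ[Rconst K ι] Mlam K ι lam hlam)

set_option synthInstance.maxHeartbeats 1000000 in
set_option maxHeartbeats 2000000 in
open Classical in
/-- The function `m` such that a homomorphism `φ : I → M_λ` is multiplication by `m`. -/
noncomputable def Mlam.multiplier (a : ι) : K :=
  if h : Rconst.single K a ∈ I then (φ ⟨Rconst.single K a, h⟩ : ι → K) a else 0

set_option synthInstance.maxHeartbeats 1000000 in
set_option maxHeartbeats 2000000 in
theorem Mlam.apply_eq_mul_multiplier (f : I) (a : ι) :
    (φ f : ι → K) a = ((f : Rconst K ι) : ι → K) a * Mlam.multiplier φ a := by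
  have hsmul : ∀ (r : Rconst K ι) (x : I),
      (φ (r • x) : ι → K) a = (r : ι → K) a * (φ x : ι → K) a := by
    intro r x
    rw [map_smul]
    rfl
  have key : (φ f : ι → K) a = (φ (Rconst.single K a • f) : ι → K) a := by
    rw [hsmul, Rconst.single_apply_self, one_mul]
  by_cases h : Rconst.single K a ∈ I
  · have e : Rconst.single K a • f = algebraMap K (Rconst K ι) (((f : Rconst K ι) : ι → K) a) •
        (⟨Rconst.single K a, h⟩ : I) :=
      Subtype.ext (Rconst.single_mul a (f : Rconst K ι))
    rw [key, e, hsmul, Mlam.multiplier, dif_pos h]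
    rfl
  · have hfa : ((f : Rconst K ι) : ι → K) a = 0 := by
      by_contra hne
      exact h (Rconst.single_mem_of_apply_ne_zero f.2 hne)
    have e : Rconst.single K a • f = 0 := by
      apply Subtype.ext
      change Rconst.single K a * (f : Rconst K ι) = 0
      rw [Rconst.single_mul, hfa, map_zero, zero_mul]
    rw [key, e, map_zero, hfa, zero_mul]
    rfl

set_option synthInstance.maxHeartbeats 1000000 in
set_option maxHeartbeats 2000000 in
theorem Mlam.multiplier_mem {S : Set (Rconst K ι)} (hS : Cardinal.mk S < lam)
    (hI : Ideal.span S = I) : Mlam.multiplier φ ∈ Mlam K ι lam hlam := by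
  change Cardinal.mk {a | Mlam.multiplier φ a ≠ 0} < lam
  by_cases h : ∀ s ∈ S, {a | (s : ι → K) a ≠ 0}.Finite
  · refine lt_of_le_of_lt (Cardinal.mk_le_mk_of_subset fun a ha => ?_)
      (Cardinal.mk_biUnion_lt_of_finite hlam hS h)
    by_contra hn
    simp only [Set.mem_iUnion, Set.mem_ofPred_eq, not_exists, not_not] at hn
    refine ha (dif_neg fun hmem => ?_)
    have h0 := Rconst.apply_eq_zero_of_mem_span hn (hI ▸ hmem)
    rw [Rconst.single_apply_self] at h0
    exact one_ne_zero h0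
  · push Not at h
    obtain ⟨s, hs, hinf⟩ := h
    have hfin := (Rconst.finite_support_or_finite_zeros s).resolve_left hinf
    have hsI : s ∈ I := hI ▸ Ideal.subset_span hs
    have hφ : Cardinal.mk {a | (φ ⟨s, hsI⟩ : ι → K) a ≠ 0} < lam := (φ ⟨s, hsI⟩).2
    refine lt_of_le_of_lt ((Cardinal.mk_le_mk_of_subset fun a ha => ?_).trans
      (Cardinal.mk_union_le _ _)) (Cardinal.add_lt_of_lt hlam hφ
        ((Cardinal.lt_aleph0_iff_set_finite.2 hfin).trans_le hlam))
    by_cases hsa : (s : ι → K) a = 0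
    · exact Or.inr hsa
    · refine Or.inl ?_
      rw [Set.mem_ofPred_eq, Mlam.apply_eq_mul_multiplier]
      exact mul_ne_zero hsa ha

end

set_option synthInstance.maxHeartbeats 1000000 in
set_option maxHeartbeats 2000000 in
/-- Let `K` be a field, `κ = #ι` for an infinite index type `ι`,
`R = R(κ,K)`, and `λ` an infinite cardinal with `λ ≤ κ⁺`. Then `M_λ` is `λ`-injective:
every `R`-homomorphism to `M_λ` from an ideal of `R` generated by fewer than `λ` elements
extends to `R`. -/
theorem Mlam_lambda_injective
    (K ι : Type u) [Field K] [Infinite ι]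
    (lam : Cardinal.{u}) (hlam : Cardinal.aleph0 ≤ lam)
    (hle : lam ≤ Order.succ (Cardinal.mk ι)) :
    ∀ I : Ideal (Rconst K ι),
      (∃ S : Set (Rconst K ι), Cardinal.mk S < lam ∧ Ideal.span S = I) →
        ∀ φ : I →ₗ[Rconst K ι] Mlam K ι lam hlam,
          ∃ ψ : Rconst K ι →ₗ[Rconst K ι] Mlam K ι lam hlam,
            ∀ (x : Rconst K ι) (hx : x ∈ I), ψ x = φ ⟨x, hx⟩ := by
  rintro I ⟨S, hS, hI⟩ φ
  refine ⟨LinearMap.toSpanSingleton _ _ ⟨Mlam.multiplier φ, Mlam.multiplier_mem φ hS hI⟩,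
    fun x hx => Subtype.ext (funext fun a => ?_)⟩
  rw [Mlam.apply_eq_mul_multiplier]
  rfl
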